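/- Let J₂ = [9] ∖ {2}, so that π_{J₂} BoolBCK ⊊ π_{J₂} BoolBCK⁺ ⊆ {0,1}^8. There exists a sequence 𝓘 = (I₁, I₃, I₄, …, I₉) of subsets of [4], each of size 3, such that (C₆* | C₆) ⊠ (C₆* | C₆) is an 𝓘-substructure of π_{J₂} BoolBCK | π_{J₂} BoolBCK⁺. -/

import Mathlib

open Set

/-- `H = (V, E)` (with vertex type `V` and ordered hyperedges `E`) is a (conditionally)
non-redundant instance of `CSP(P | Q)`: for each edge `e` there is an assignment that
`P`-satisfies every other edge but `Q \ P`-satisfies `e`.  For plain non-redundancy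
take `Q = Set.univ`. -/
def IsNRDInstance {ι D V : Type*} (P Q : Set (ι → D)) (E : Set (ι → V)) : Prop :=
  ∀ e ∈ E, ∃ ψ : V → D,
    (∀ e' ∈ E, e' ≠ e → (fun i => ψ (e' i)) ∈ P) ∧ (fun i => ψ (e i)) ∈ Q \ P

/-- `NRD(P | Q, n)`: the maximum number of edges of a non-redundant instance of
`CSP(P | Q)` on `n` vertices. -/
noncomputable def NRD {ι D : Type*} (P Q : Set (ι → D)) (n : ℕ) : ℕ :=
  sSup {m | ∃ E : Set (ι → Fin n), IsNRDInstance P Q E ∧ E.ncard = m}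

/-- A partite non-redundant instance of `CSP(P | Q)`: the vertex set is the disjoint
union of the parts `V i`, and each edge selects one vertex from each part. -/
def IsPartiteNRDInstance {ι D : Type*} {V : ι → Type*} (P Q : Set (ι → D))
    (E : Set (∀ i, V i)) : Prop :=
  ∀ e ∈ E, ∃ ψ : ∀ i, V i → D,
    (∀ e' ∈ E, e' ≠ e → (fun i => ψ i (e' i)) ∈ P) ∧ (fun i => ψ i (e i)) ∈ Q \ P

/-- Projection `π_I` of a tuple onto the coordinates in `I`. -/
def proj {ι : Type*} (I : Set ι) {X : ι → Type*} (e : ∀ i, X i) : ∀ i : I, X i.1 :=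
  fun i => e i.1

/-- `P | Q` is an `𝓘`-substructure of `R | S`. -/
def IsSubstructure {ι₁ ι₂ D₁ D₂ : Type*} (P Q : Set (ι₁ → D₁)) (R S : Set (ι₂ → D₂))
    (𝓘 : ι₂ → Set ι₁) : Prop :=
  ∃ g : ∀ j : ι₂, (↥(𝓘 j) → D₁) → D₂,
    (∀ x ∈ P, (fun j => g j (fun i => x i.1)) ∈ R) ∧
    (∀ x ∈ Q \ P, (fun j => g j (fun i => x i.1)) ∈ S \ R)

/-- The `Q`-part of the box product of conditional predicates. -/
def boxQ {ι₁ ι₂ D : Type*} (Q₁ : Set (ι₁ → D)) (Q₂ : Set (ι₂ → D)) : Set (ι₁ ⊕ ι₂ → D) :=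
  {x | (fun i => x (Sum.inl i)) ∈ Q₁ ∧ (fun i => x (Sum.inr i)) ∈ Q₂}

/-- The `P`-part of the box product: `P₃ = (P₁ × Q₂) ∪ (Q₁ × P₂)`. -/
def boxP {ι₁ ι₂ D : Type*} (P₁ Q₁ : Set (ι₁ → D)) (P₂ Q₂ : Set (ι₂ → D)) :
    Set (ι₁ ⊕ ι₂ → D) :=
  {x | ((fun i => x (Sum.inl i)) ∈ P₁ ∧ (fun i => x (Sum.inr i)) ∈ Q₂) ∨
       ((fun i => x (Sum.inl i)) ∈ Q₁ ∧ (fun i => x (Sum.inr i)) ∈ P₂)}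

/-- The 6-cycle `C₆` as a binary predicate over `{0,1,2}`. -/
def C6 : Set (Fin 2 → Fin 3) := {![0,0], ![0,1], ![1,0], ![1,2], ![2,1], ![2,2]}

/-- `C₆* = C₆ ∖ {(0,0)}`. -/
def C6star : Set (Fin 2 → Fin 3) := C6 \ {![0,0]}

/-- `BoolBCK⁺`: the six 3×3 permutation matrices, written row-major as 9-tuples over `{0,1}`. -/
def BoolBCKplus : Set (Fin 9 → Fin 2) :=
  {![1,0,0,0,1,0,0,0,1], ![0,1,0,1,0,0,0,0,1], ![0,0,1,0,1,0,1,0,0],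
   ![1,0,0,0,0,1,0,1,0], ![0,0,1,1,0,0,0,1,0], ![0,1,0,0,0,1,1,0,0]}

/-- `BoolBCK = BoolBCK⁺` minus the identity matrix. -/
def BoolBCK : Set (Fin 9 → Fin 2) := BoolBCKplus \ {![1,0,0,0,1,0,0,0,1]}

/-- The omitted coordinate for each of the target positions. -/
def omitted : Fin 9 → Fin 2 ⊕ Fin 2 :=
  ![.inr 1, .inl 0, .inr 0, .inl 1, .inl 1, .inl 1, .inl 0, .inl 0, .inl 0]

/-- The six permutation matrices. -/
def permMat : Fin 6 → Fin 9 → Fin 2 :=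
  ![![1,0,0,0,1,0,0,0,1], ![0,1,0,1,0,0,0,0,1], ![0,0,1,0,1,0,1,0,0],
   ![1,0,0,0,0,1,0,1,0], ![0,0,1,1,0,0,0,1,0], ![0,1,0,0,0,1,1,0,0]]

/-- The six elements of `C6`. -/
def c6El : Fin 6 → Fin 2 → Fin 3 := ![![0,0], ![0,1], ![1,0], ![1,2], ![2,1], ![2,2]]

/-- Index of a pair of `C6` (junk outside). -/
def c6Idx (a b : Fin 3) : Fin 6 := (![![0,1,0], ![2,0,3], ![0,4,5]] : Fin 3 → Fin 3 → Fin 6) a b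

/-- Which permutation is used at each point of `C6 × C6`. -/
def permTable : Fin 6 → Fin 6 → Fin 6 :=
  ![![0,3,1,4,5,2], ![2,5,4,4,5,2], ![1,4,1,4,2,2], ![4,4,4,4,2,2], ![5,5,3,3,5,5], ![3,3,3,3,5,5]]

/-- The total map on points. -/
def pointMap (x : Fin 2 ⊕ Fin 2 → Fin 3) : Fin 9 → Fin 2 :=
  permMat (permTable (c6Idx (x (.inl 0)) (x (.inl 1))) (c6Idx (x (.inr 0)) (x (.inr 1))))

/-- The other coordinate of the same pair. -/
def partner : Fin 2 ⊕ Fin 2 → Fin 2 ⊕ Fin 2 := Sum.map (fun i => 1 - i) (fun i => 1 - i)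

/-- Fill the omitted coordinate with a value that is a `C6`-neighbour of its partner. -/
def refill (j : Fin 9) (x : Fin 2 ⊕ Fin 2 → Fin 3) : Fin 2 ⊕ Fin 2 → Fin 3 :=
  fun i => if i = omitted j then ![0,0,1] (x (partner i)) else x i

/-- The `(s,t)` point of `C6 × C6`. -/
def boxPt (s t : Fin 6) : Fin 2 ⊕ Fin 2 → Fin 3 := Sum.elim (c6El s) (c6El t)

theorem refill_boxPt : ∀ (s t : Fin 6) (j : Fin 9), j ≠ 1 →
    pointMap (refill j (fun i => if i = omitted j then 0 else boxPt s t i)) j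
      = permMat (permTable s t) j := by
  decide +kernel

theorem permTable_ne : ∀ s t : Fin 6, ¬ (s = 0 ∧ t = 0) → permTable s t ≠ 0 := by decide

theorem permMat_sep : ∀ k : Fin 6, k ≠ 0 → ∃ j : Fin 9, j ≠ 1 ∧ permMat k j ≠ permMat 0 j := by
  decide

theorem mem_C6_iff (x : Fin 2 → Fin 3) : x ∈ C6 ↔ ∃ s, x = c6El s := by
  simp [C6, c6El, Fin.exists_fin_succ]

theorem mem_plus_iff (x : Fin 9 → Fin 2) : x ∈ BoolBCKplus ↔ ∃ k, x = permMat k := by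
  simp [BoolBCKplus, permMat, Fin.exists_fin_succ]

theorem permMat_mem {k : Fin 6} (hk : k ≠ 0) : permMat k ∈ BoolBCK := by
  refine ⟨(mem_plus_iff _).2 ⟨k, rfl⟩, fun h => ?_⟩
  obtain ⟨j, -, hj⟩ := permMat_sep k hk
  exact hj (congrFun h j)

theorem mem_BCK {x : Fin 9 → Fin 2} (h : x ∈ BoolBCK) : ∃ k, k ≠ 0 ∧ x = permMat k := by
  obtain ⟨k, rfl⟩ := (mem_plus_iff _).1 h.1
  refine ⟨k, ?_, rfl⟩
  rintro rfl
  exact h.2 rfl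

theorem mem_boxQ {x : Fin 2 ⊕ Fin 2 → Fin 3} (h : x ∈ boxQ C6 C6) : ∃ s t, x = boxPt s t := by
  obtain ⟨s, hs⟩ := (mem_C6_iff _).1 h.1
  obtain ⟨t, ht⟩ := (mem_C6_iff _).1 h.2
  refine ⟨s, t, ?_⟩
  funext i
  rcases i with i | i
  · exact congrFun hs i
  · exact congrFun ht i

theorem c6El_mem_star {s : Fin 6} (hs : s ≠ 0) : c6El s ∈ C6star := by
  refine ⟨(mem_C6_iff _).2 ⟨s, rfl⟩, fun h => ?_⟩
  have : ∀ s : Fin 6, c6El s = ![0,0] → s = 0 := by decide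
  exact hs (this s h)

theorem boxPt_of_boxP {x : Fin 2 ⊕ Fin 2 → Fin 3} (h : x ∈ boxP C6star C6 C6star C6) :
    ∃ s t, x = boxPt s t ∧ ¬ (s = 0 ∧ t = 0) := by
  have hQ : x ∈ boxQ C6 C6 := by
    rcases h with h | h
    · exact ⟨h.1.1, h.2⟩
    · exact ⟨h.1, h.2.1⟩
  obtain ⟨s, t, rfl⟩ := mem_boxQ hQ
  refine ⟨s, t, rfl, ?_⟩
  rintro ⟨rfl, rfl⟩
  rcases h with h | h
  · exact h.1.2 rfl
  · exact h.2.2 rfl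

theorem boxPt_of_diff {x : Fin 2 ⊕ Fin 2 → Fin 3}
    (h : x ∈ boxQ C6 C6 \ boxP C6star C6 C6star C6) : x = boxPt 0 0 := by
  obtain ⟨s, t, rfl⟩ := mem_boxQ h.1
  by_cases hs : s = 0
  · by_cases ht : t = 0
    · rw [hs, ht]
    · exact absurd (Or.inr ⟨h.1.1, c6El_mem_star ht⟩) h.2
  · exact absurd (Or.inl ⟨c6El_mem_star hs, h.1.2⟩) h.2

/-- Lemma: with J₂ = [9] ∖ {2} (0-indexed: the complement of {1} in `Fin 9`), there is a
sequence `𝓘` of subsets of [4] (here: of `Fin 2 ⊕ Fin 2`), each of size 3, such that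
`(C₆* | C₆) ⊠ (C₆* | C₆)` is an `𝓘`-substructure of the projection of
`BoolBCK | BoolBCK⁺` onto the coordinates in J₂ = [9] ∖ {2}. -/
theorem boxC6_substructure_of_BoolBCK_proj :
    ∃ 𝓘 : ↥({1}ᶜ : Set (Fin 9)) → Set (Fin 2 ⊕ Fin 2),
      (∀ j, (𝓘 j).ncard = 3) ∧
      IsSubstructure (boxP C6star C6 C6star C6) (boxQ C6 C6)
        (proj ({1}ᶜ : Set (Fin 9)) '' BoolBCK)
        (proj ({1}ᶜ : Set (Fin 9)) '' BoolBCKplus) 𝓘 := by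
  classical
  refine ⟨fun j => {omitted j.1}ᶜ, fun j => ?_,
    fun j y => pointMap (refill j.1
      (fun i => if h : i = omitted j.1 then 0 else y ⟨i, h⟩)) j.1, ?_, ?_⟩
  · have h := Set.ncard_add_ncard_compl ({omitted j.1} : Set (Fin 2 ⊕ Fin 2))
    simp at h
    show ({omitted j.1}ᶜ : Set (Fin 2 ⊕ Fin 2)).ncard = 3
    omega
  · intro x hx
    obtain ⟨s, t, rfl, hst⟩ := boxPt_of_boxP hx
    refine ⟨permMat (permTable s t), permMat_mem (permTable_ne s t hst), ?_⟩
    funext j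
    exact (refill_boxPt s t j.1 j.2).symm
  · intro x hx
    obtain rfl := boxPt_of_diff hx
    have key : (fun j : ↥({1}ᶜ : Set (Fin 9)) => pointMap (refill j.1
        (fun i => if h : i = omitted j.1 then 0 else boxPt 0 0 i)) j.1)
        = proj ({1}ᶜ : Set (Fin 9)) (permMat 0) := by
      funext j
      exact refill_boxPt 0 0 j.1 j.2
    refine ⟨⟨permMat 0, (mem_plus_iff _).2 ⟨0, rfl⟩, key.symm⟩, ?_⟩
    rintro ⟨y, hy, hyx⟩
    obtain ⟨k, hk, rfl⟩ := mem_BCK hy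
    obtain ⟨j, hj1, hj⟩ := permMat_sep k hk
    exact hj (congrFun (hyx.trans key) ⟨j, hj1⟩)
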